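/- Let f: {-1,1}^N → [-1,1] be a function of degree at most d (i.e., f̂(S) = 0 whenever |S| > d). Then (∑_{0 < |S| ≤ d} f̂(S)²)^{1/2} ≤ 2 e^d (1 − |f̂(∅)|). -/

import Mathlib

def cubeChi (b : Bool) : ℝ := if b then 1 else -1

noncomputable def wCoeff {N : ℕ} (f : (Fin N → Bool) → ℝ) (S : Finset (Fin N)) : ℝ :=
  (∑ x : Fin N → Bool, f x * ∏ i ∈ S, cubeChi (x i)) / 2 ^ N

noncomputable def cubeSup {N : ℕ} (f : (Fin N → Bool) → ℝ) : ℝ :=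
  Finset.univ.sup' Finset.univ_nonempty (fun x => |f x|)

noncomputable def cubeAvg {N : ℕ} (f : (Fin N → Bool) → ℝ) : ℝ :=
  (∑ x : Fin N → Bool, f x) / 2 ^ N

open Real Finset

/-- Flip the `i`-th coordinate of a point of the cube. -/
def cubeFlip {N : ℕ} (i : Fin N) (x : Fin N → Bool) : Fin N → Bool :=
  Function.update x i (!x i)

theorem cubeFlip_involutive {N : ℕ} (i : Fin N) :
    Function.Involutive (cubeFlip i) := by
  intro x
  simp [cubeFlip]

theorem log_le_half_sub_inv {y : ℝ} (hy : 1 ≤ y) : 2 * log y ≤ y - y⁻¹ := by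
  have h0 : 0 < y := by linarith
  have h := self_le_sinh_iff.2 (log_nonneg hy)
  rw [sinh_eq, exp_neg, exp_log h0] at h
  linarith

theorem log_one_add_sub_log_one_sub_le {s : ℝ} (h0 : 0 ≤ s) (h1 : s < 1) :
    log (1 + s) - log (1 - s) ≤ 2 * s / √(1 - s ^ 2) := by
  have ha : 0 < 1 + s := by linarith
  have hb : 0 < 1 - s := by linarith
  have hy : 1 ≤ √((1 + s) / (1 - s)) := by
    rw [one_le_sqrt, one_le_div hb]
    linarith
  have h := log_le_half_sub_inv hy
  rw [log_sqrt (by positivity), log_div ha.ne' hb.ne', sqrt_div ha.le, inv_div] at h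
  have e : 1 - s ^ 2 = (1 + s) * (1 - s) := by ring
  have hsa : 0 < √(1 + s) := sqrt_pos.2 ha
  have hsb : 0 < √(1 - s) := sqrt_pos.2 hb
  have h2 : √(1 + s) / √(1 - s) - √(1 - s) / √(1 + s) = 2 * s / √(1 - s ^ 2) := by
    rw [e, sqrt_mul ha.le]
    field_simp
    rw [sq_sqrt ha.le, sq_sqrt hb.le]
    ring
  linarith

theorem binary_entropy_le_of_nonneg {s : ℝ} (h0 : 0 ≤ s) (h1 : s ≤ 1) :
    (1 + s) * log (1 + s) + (1 - s) * log (1 - s) ≤ 2 * (1 - √(1 - s ^ 2)) := by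
  have hmono : MonotoneOn (fun s : ℝ => 2 * (1 - √(1 - s ^ 2)) -
      ((1 + s) * log (1 + s) + (1 - s) * log (1 - s))) (Set.Icc 0 1) := by
    apply monotoneOn_of_hasDerivWithinAt_nonneg (convex_Icc 0 1)
      (f' := fun s => 2 * s / √(1 - s ^ 2) - (log (1 + s) - log (1 - s)))
    · have hc1 : Continuous fun s : ℝ => (1 + s) * log (1 + s) :=
        continuous_mul_log.comp (continuous_const.add continuous_id)
      have hc2 : Continuous fun s : ℝ => (1 - s) * log (1 - s) :=
        continuous_mul_log.comp (continuous_const.sub continuous_id)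
      exact Continuous.continuousOn (by fun_prop)
    · intro t ht
      rw [interior_Icc] at ht
      obtain ⟨ht0, ht1⟩ := ht
      have hp : 1 + t ≠ 0 := by linarith
      have hm : 1 - t ≠ 0 := by linarith
      have hq : 1 - t ^ 2 ≠ 0 := by nlinarith
      have d1 := ((hasDerivAt_id t).const_add 1)
      have d2 := ((hasDerivAt_id t).const_sub 1)
      have e1 := d1.mul (d1.log hp)
      have e2 := d2.mul (d2.log hm)
      have e3 := ((((hasDerivAt_id t).pow 2).const_sub 1).sqrt hq).const_sub 1 |>.const_mul 2
      refine ((e3.sub (e1.add e2)).congr_deriv ?_).hasDerivWithinAt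
      have : √(1 - t ^ 2) ≠ 0 := (sqrt_pos.2 (by nlinarith)).ne'
      simp only [id, Pi.pow_apply]
      field_simp
      ring
    · intro t ht
      rw [interior_Icc] at ht
      linarith [log_one_add_sub_log_one_sub_le ht.1.le ht.2]
  have h := hmono (Set.left_mem_Icc.2 zero_le_one) ⟨h0, h1⟩ h0
  norm_num at h
  linarith

theorem binary_entropy_le {s : ℝ} (hs : |s| ≤ 1) :
    (1 + s) * log (1 + s) + (1 - s) * log (1 - s) ≤ 2 * (1 - √(1 - s ^ 2)) := by
  obtain ⟨hl, hr⟩ := abs_le.1 hs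
  rcases le_total 0 s with h | h
  · exact binary_entropy_le_of_nonneg h hr
  · have := binary_entropy_le_of_nonneg (s := -s) (by linarith) (by linarith)
    rw [neg_sq, sub_neg_eq_add, ← sub_eq_add_neg] at this
    linarith

/-- The logarithmic Sobolev inequality on a two-point space. -/
theorem log_sobolev_two_point (p q : ℝ) :
    p ^ 2 * log (p ^ 2) + q ^ 2 * log (q ^ 2) ≤
      (p ^ 2 + q ^ 2) * log ((p ^ 2 + q ^ 2) / 2) + (p - q) ^ 2 := by
  obtain ⟨m, hm⟩ : ∃ m, m = (p ^ 2 + q ^ 2) / 2 := ⟨_, rfl⟩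
  rcases eq_or_ne m 0 with h0 | h0
  · have hp : p = 0 := by nlinarith [sq_nonneg p, sq_nonneg q]
    have hq : q = 0 := by nlinarith [sq_nonneg p, sq_nonneg q]
    simp [hp, hq]
  have hmpos : 0 < m := lt_of_le_of_ne (by rw [hm]; positivity) h0.symm
  obtain ⟨s, hs⟩ : ∃ s, s = (p ^ 2 - q ^ 2) / (2 * m) := ⟨_, rfl⟩
  have hms : m * s = (p ^ 2 - q ^ 2) / 2 := by rw [hs]; field_simp
  have hp : p ^ 2 = m * (1 + s) := by linarith
  have hq : q ^ 2 = m * (1 - s) := by linarith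
  have hs1 : |s| ≤ 1 := by
    rw [abs_le]
    constructor
    · nlinarith [sq_nonneg p]
    · nlinarith [sq_nonneg q]
  have key := mul_le_mul_of_nonneg_left (binary_entropy_le hs1) hmpos.le
  have hsqrt : m * √(1 - s ^ 2) = |p * q| := by
    rw [← sqrt_sq_eq_abs, mul_pow, hp, hq,
      show m * (1 + s) * (m * (1 - s)) = m ^ 2 * (1 - s ^ 2) by ring,
      sqrt_mul (sq_nonneg m), sqrt_sq hmpos.le]
  have hlog : ∀ t : ℝ, m * t * log (m * t) = m * t * log m + m * (t * log t) := by
    intro t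
    rcases eq_or_ne t 0 with rfl | ht
    · simp
    · rw [log_mul h0 ht]
      ring
  rw [← hm, show (p - q) ^ 2 = p ^ 2 + q ^ 2 - 2 * (p * q) by ring, hp, hq, hlog, hlog]
  nlinarith [le_abs_self (p * q)]

theorem sqrt_mean_sq_sub_sq_le (a b c d : ℝ) :
    (√((a ^ 2 + b ^ 2) / 2) - √((c ^ 2 + d ^ 2) / 2)) ^ 2 ≤
      ((a - c) ^ 2 + (b - d) ^ 2) / 2 := by
  have h1 : (0 : ℝ) ≤ (a ^ 2 + b ^ 2) / 2 := by positivity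
  have h2 : (0 : ℝ) ≤ (c ^ 2 + d ^ 2) / 2 := by positivity
  have key : (a * c + b * d) / 2 ≤ √((a ^ 2 + b ^ 2) / 2) * √((c ^ 2 + d ^ 2) / 2) := by
    rw [← sqrt_mul h1]
    apply le_sqrt_of_sq_le
    nlinarith [sq_nonneg (a * d - b * c)]
  nlinarith [sq_sqrt h1, sq_sqrt h2]

theorem sum_cube_succ {n : ℕ} (F : (Fin (n + 1) → Bool) → ℝ) :
    ∑ x, F x = ∑ y : Fin n → Bool, (F (Fin.cons true y) + F (Fin.cons false y)) := by
  rw [← (Fin.consEquiv fun _ : Fin (n + 1) => Bool).sum_comp F, Fintype.sum_prod_type_right]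
  simp [Fin.consEquiv]

theorem cubeFlip_cons_zero {n : ℕ} (b : Bool) (y : Fin n → Bool) :
    cubeFlip 0 (Fin.cons b y : Fin (n + 1) → Bool) = Fin.cons (!b) y := by
  simp [cubeFlip]

theorem cubeFlip_cons_succ {n : ℕ} (i : Fin n) (b : Bool) (y : Fin n → Bool) :
    cubeFlip i.succ (Fin.cons b y : Fin (n + 1) → Bool) = Fin.cons b (cubeFlip i y) := by
  simp [cubeFlip, Fin.cons_update]

/-- The logarithmic Sobolev inequality on the discrete cube. -/
theorem log_sobolev_cube {n : ℕ} (f : (Fin n → Bool) → ℝ) :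
    ∑ x, f x ^ 2 * log (f x ^ 2) ≤
      (∑ x, f x ^ 2) * log ((∑ x, f x ^ 2) / 2 ^ n) +
        1 / 2 * ∑ i, ∑ x, (f x - f (cubeFlip i x)) ^ 2 := by
  induction n with
  | zero => simp
  | succ n ih =>
    let G : (Fin n → Bool) → ℝ := fun y =>
      √((f (Fin.cons true y) ^ 2 + f (Fin.cons false y) ^ 2) / 2)
    have hG : ∀ y, G y ^ 2 = (f (Fin.cons true y) ^ 2 + f (Fin.cons false y) ^ 2) / 2 :=
      fun y => sq_sqrt (by positivity)
    have hsum : ∑ x, f x ^ 2 = 2 * ∑ y, G y ^ 2 := by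
      rw [sum_cube_succ, mul_sum]
      exact sum_congr rfl fun y _ => by rw [hG]; ring
    have hent : ∑ x, f x ^ 2 * log (f x ^ 2) ≤ 2 * ∑ y, G y ^ 2 * log (G y ^ 2) +
        ∑ y : Fin n → Bool, (f (Fin.cons true y) - f (Fin.cons false y)) ^ 2 := by
      rw [sum_cube_succ, mul_sum, ← sum_add_distrib]
      refine sum_le_sum fun y _ => ?_
      have := log_sobolev_two_point (f (Fin.cons true y)) (f (Fin.cons false y))
      rw [hG]
      linarith
    have hzero : ∑ x, (f x - f (cubeFlip 0 x)) ^ 2 =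
        2 * ∑ y : Fin n → Bool, (f (Fin.cons true y) - f (Fin.cons false y)) ^ 2 := by
      rw [sum_cube_succ, mul_sum]
      refine sum_congr rfl fun y _ => ?_
      rw [cubeFlip_cons_zero, cubeFlip_cons_zero, Bool.not_true, Bool.not_false]
      ring
    have hsucc : 2 * ∑ i, ∑ y, (G y - G (cubeFlip i y)) ^ 2 ≤
        ∑ i : Fin n, ∑ x, (f x - f (cubeFlip i.succ x)) ^ 2 := by
      rw [mul_sum]
      refine sum_le_sum fun i _ => ?_
      rw [sum_cube_succ, mul_sum]
      refine sum_le_sum fun y _ => ?_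
      rw [cubeFlip_cons_succ, cubeFlip_cons_succ]
      have := sqrt_mean_sq_sub_sq_le (f (Fin.cons true y)) (f (Fin.cons false y))
        (f (Fin.cons true (cubeFlip i y))) (f (Fin.cons false (cubeFlip i y)))
      simp only [G]
      linarith
    rw [Fin.sum_univ_succ, hzero, hsum, pow_succ',
      mul_div_mul_left _ _ (two_ne_zero : (2 : ℝ) ≠ 0)]
    linarith [ih G]

theorem cubeChi_not (b : Bool) : cubeChi (!b) = -cubeChi b := by
  cases b <;> simp [cubeChi]

theorem sum_prod_cubeChi_mul {N : ℕ} (x y : Fin N → Bool) :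
    ∑ S : Finset (Fin N), (∏ i ∈ S, cubeChi (x i)) * ∏ i ∈ S, cubeChi (y i) =
      if x = y then 2 ^ N else 0 := by
  simp_rw [← prod_mul_distrib]
  rw [← powerset_univ, ← prod_one_add]
  split_ifs with h
  · subst h
    have : ∀ b, 1 + cubeChi b * cubeChi b = 2 := by
      intro b
      cases b <;> norm_num [cubeChi]
    simp [this]
  · obtain ⟨i, hi⟩ := Function.ne_iff.1 h
    refine prod_eq_zero (mem_univ i) ?_
    cases hx : x i <;> cases hy : y i <;> simp_all [cubeChi]

/-- Parseval's identity on the discrete cube. -/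
theorem sum_wCoeff_sq {N : ℕ} (f : (Fin N → Bool) → ℝ) :
    ∑ S, wCoeff f S ^ 2 = (∑ x, f x ^ 2) / 2 ^ N := by
  have h : ∑ S : Finset (Fin N), (∑ x, f x * ∏ i ∈ S, cubeChi (x i)) ^ 2 =
      2 ^ N * ∑ x, f x ^ 2 := by
    simp_rw [sq, sum_mul_sum]
    rw [sum_comm, mul_sum]
    refine sum_congr rfl fun x _ => ?_
    rw [sum_comm]
    have : ∀ y, ∑ S : Finset (Fin N), (f x * ∏ i ∈ S, cubeChi (x i)) *
        (f y * ∏ i ∈ S, cubeChi (y i)) = f x * f y * if x = y then 2 ^ N else 0 := by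
      intro y
      rw [← sum_prod_cubeChi_mul, mul_sum]
      exact sum_congr rfl fun S _ => by ring
    simp_rw [this]
    simp only [mul_ite, mul_zero, sum_ite_eq, mem_univ, if_true]
    ring
  simp_rw [wCoeff, div_pow]
  rw [← sum_div, h]
  field_simp

theorem prod_cubeChi_cubeFlip {N : ℕ} (i : Fin N) (S : Finset (Fin N)) (x : Fin N → Bool) :
    ∏ j ∈ S, cubeChi (cubeFlip i x j) =
      (if i ∈ S then -1 else 1) * ∏ j ∈ S, cubeChi (x j) := by
  have hne : ∀ j, j ≠ i → cubeChi (cubeFlip i x j) = cubeChi (x j) := by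
    intro j hj
    simp [cubeFlip, hj]
  split_ifs with h
  · rw [← mul_prod_erase S _ h, ← mul_prod_erase S (fun j => cubeChi (x j)) h,
      prod_congr rfl fun j hj => hne j (ne_of_mem_erase hj)]
    simp [cubeFlip, cubeChi_not]
  · rw [one_mul]
    exact prod_congr rfl fun j hj => hne j fun e => h (e ▸ hj)

theorem wCoeff_sub_cubeFlip {N : ℕ} (f : (Fin N → Bool) → ℝ) (i : Fin N)
    (S : Finset (Fin N)) :
    wCoeff (fun x => f x - f (cubeFlip i x)) S = if i ∈ S then 2 * wCoeff f S else 0 := by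
  have h : ∑ x, f (cubeFlip i x) * ∏ j ∈ S, cubeChi (x j) =
      (if i ∈ S then -1 else 1) * ∑ x, f x * ∏ j ∈ S, cubeChi (x j) := by
    rw [← Equiv.sum_comp (cubeFlip_involutive i).toPerm, mul_sum]
    refine sum_congr rfl fun x _ => ?_
    rw [Function.Involutive.coe_toPerm, cubeFlip_involutive, prod_cubeChi_cubeFlip]
    ring
  simp only [wCoeff, sub_mul, sum_sub_distrib, h]
  split_ifs <;> ring

theorem sum_sub_cubeFlip_sq {N : ℕ} (f : (Fin N → Bool) → ℝ) :
    ∑ i, ∑ x, (f x - f (cubeFlip i x)) ^ 2 =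
      2 ^ N * (4 * ∑ S : Finset (Fin N), S.card * wCoeff f S ^ 2) := by
  have h : ∀ i, ∑ x, (f x - f (cubeFlip i x)) ^ 2 =
      2 ^ N * ∑ S, if i ∈ S then 4 * wCoeff f S ^ 2 else 0 := by
    intro i
    have := sum_wCoeff_sq fun x => f x - f (cubeFlip i x)
    rw [eq_div_iff (by positivity)] at this
    rw [← this, mul_comm]
    congr 1
    refine sum_congr rfl fun S _ => ?_
    rw [wCoeff_sub_cubeFlip]
    split_ifs <;> ring
  simp_rw [h]
  rw [← mul_sum, sum_comm]
  congr 1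
  rw [mul_sum]
  refine sum_congr rfl fun S _ => ?_
  rw [← sum_filter, sum_const, filter_univ_mem, nsmul_eq_mul]
  ring

/-- Comparison of the `L²` and `L¹` norms of a function of degree at most `d`. -/
theorem sqrt_cubeAvg_sq_le {N d : ℕ} (f : (Fin N → Bool) → ℝ)
    (hd : ∀ S : Finset (Fin N), d < S.card → wCoeff f S = 0) :
    √((∑ x, f x ^ 2) / 2 ^ N) ≤ exp d * ((∑ x, |f x|) / 2 ^ N) := by
  obtain ⟨A, hA⟩ : ∃ A, A = ∑ x, f x ^ 2 := ⟨_, rfl⟩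
  obtain ⟨B, hB⟩ : ∃ B, B = ∑ x, |f x| := ⟨_, rfl⟩
  have hA0 : 0 ≤ A := hA ▸ sum_nonneg fun x _ => sq_nonneg _
  have hB0 : 0 ≤ B := hB ▸ sum_nonneg fun x _ => abs_nonneg _
  rw [← hA, ← hB]
  rcases hA0.eq_or_lt with h0 | hApos
  · rw [← h0, zero_div, sqrt_zero]
    positivity
  have hBpos : 0 < B := by
    refine lt_of_le_of_ne hB0 fun h => hApos.ne' ?_
    rw [hB, eq_comm, sum_eq_zero_iff_of_nonneg fun x _ => abs_nonneg _] at h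
    rw [hA]
    exact sum_eq_zero fun x hx => by rw [← sq_abs, h x hx]; norm_num
  have henergy : 1 / 2 * ∑ i, ∑ x, (f x - f (cubeFlip i x)) ^ 2 ≤ 2 * d * A := by
    have hle : ∑ S : Finset (Fin N), S.card * wCoeff f S ^ 2 ≤ d * (A / 2 ^ N) := by
      rw [hA, ← sum_wCoeff_sq, mul_sum]
      refine sum_le_sum fun S _ => ?_
      rcases lt_or_ge d S.card with h | h
      · simp [hd S h]
      · gcongr
    rw [sum_sub_cubeFlip_sq]
    calc _ = 2 * 2 ^ N * ∑ S : Finset (Fin N), S.card * wCoeff f S ^ 2 := by ring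
      _ ≤ 2 * 2 ^ N * (d * (A / 2 ^ N)) := by gcongr
      _ = _ := by field_simp
  have hjensen : -∑ x, f x ^ 2 * log (f x ^ 2) ≤ 2 * A * log (B / A) := by
    have hpt : ∀ x, -(f x ^ 2 * log (f x ^ 2)) ≤
        2 * f x ^ 2 * log (B / A) + 2 * (|f x| * (A / B) - f x ^ 2) := by
      intro x
      rcases eq_or_ne (f x) 0 with h | h
      · simp [h]
      have hpos : 0 < |f x| := abs_pos.2 h
      have hl := log_le_sub_one_of_pos (show 0 < (B / A * |f x|)⁻¹ by positivity)
      rw [log_inv, log_mul (by positivity) hpos.ne'] at hl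
      have hm := mul_le_mul_of_nonneg_left hl (show 0 ≤ 2 * |f x| ^ 2 by positivity)
      have he : 2 * |f x| ^ 2 * ((B / A * |f x|)⁻¹ - 1) =
          2 * (|f x| * (A / B) - |f x| ^ 2) := by
        field_simp
      rw [he] at hm
      rw [← sq_abs, log_pow]
      push_cast
      linarith
    have hs := sum_le_sum fun x (_ : x ∈ univ) => hpt x
    rw [sum_neg_distrib, sum_add_distrib, ← sum_mul, ← mul_sum, ← mul_sum, sum_sub_distrib,
      ← sum_mul, ← hA, ← hB, mul_div_cancel₀ _ hBpos.ne'] at hs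
    linarith
  have hls := log_sobolev_cube f
  rw [← hA] at hls
  have hlog : 0 ≤ log (A / 2 ^ N) + 2 * d + 2 * log (B / A) := by
    by_contra! h
    nlinarith
  have hfin : log (√(A / 2 ^ N)) ≤ log (exp d * (B / 2 ^ N)) := by
    rw [log_sqrt (by positivity), log_mul (exp_ne_zero _) (by positivity), log_exp]
    rw [log_div hApos.ne' (by positivity), log_div hBpos.ne' hApos.ne'] at hlog
    rw [log_div hApos.ne' (by positivity), log_div hBpos.ne' (by positivity)]
    linarith
  exact (log_le_log_iff (by positivity) (by positivity)).1 hfin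

theorem wCoeff_empty {N : ℕ} (f : (Fin N → Bool) → ℝ) :
    wCoeff f ∅ = (∑ x, f x) / 2 ^ N := by
  simp [wCoeff]

theorem wCoeff_const {N : ℕ} (c : ℝ) {S : Finset (Fin N)} (hS : S.Nonempty) :
    wCoeff (fun _ => c) S = 0 := by
  obtain ⟨i, hi⟩ := hS
  have h := wCoeff_sub_cubeFlip (fun _ : Fin N → Bool => c) i S
  have h0 : wCoeff (fun _ : Fin N → Bool => (0 : ℝ)) S = 0 := by simp [wCoeff]
  simp only [sub_self, hi, if_true, h0] at h
  linarith

theorem wCoeff_sub {N : ℕ} (f g : (Fin N → Bool) → ℝ) (S : Finset (Fin N)) :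
    wCoeff (fun x => f x - g x) S = wCoeff f S - wCoeff g S := by
  simp only [wCoeff, sub_mul, sum_sub_distrib, sub_div]

theorem cubeAvg_abs_sub_wCoeff_empty_le {N : ℕ} (f : (Fin N → Bool) → ℝ)
    (hf : ∀ x, f x ∈ Set.Icc (-1 : ℝ) 1) :
    (∑ x, |f x - wCoeff f ∅|) / 2 ^ N ≤ 2 * (1 - |wCoeff f ∅|) := by
  obtain ⟨a, ha⟩ : ∃ a, a = wCoeff f ∅ := ⟨_, rfl⟩
  rw [← ha]
  have hsum : ∑ x, f x = a * 2 ^ N := by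
    rw [ha, wCoeff_empty]
    field_simp
  have hcard : ∀ c : ℝ, ∑ _x : Fin N → Bool, c = 2 ^ N * c := by
    intro c
    simp
  have hle : a ≤ 1 := by
    have := sum_le_sum fun x (_ : x ∈ univ) => (hf x).2
    rw [hsum, hcard] at this
    nlinarith [show (0 : ℝ) < 2 ^ N by positivity]
  have hge : -1 ≤ a := by
    have := sum_le_sum fun x (_ : x ∈ univ) => (hf x).1
    rw [hsum, hcard] at this
    nlinarith [show (0 : ℝ) < 2 ^ N by positivity]
  rw [div_le_iff₀ (by positivity)]
  rcases le_total 0 a with h | h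
  · rw [abs_of_nonneg h]
    calc ∑ x, |f x - a| ≤ ∑ x, ((2 - a) - f x) := by
          refine sum_le_sum fun x _ => ?_
          have := (hf x).2
          rw [abs_le]
          constructor <;> linarith
      _ = _ := by rw [sum_sub_distrib, hsum, hcard]; ring
  · rw [abs_of_nonpos h]
    calc ∑ x, |f x - a| ≤ ∑ x, ((2 + a) + f x) := by
          refine sum_le_sum fun x _ => ?_
          have := (hf x).1
          rw [abs_le]
          constructor <;> linarith
      _ = _ := by rw [sum_add_distrib, hsum, hcard]; ring

theorem stmt11 {N d : ℕ} (f : (Fin N → Bool) → ℝ)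
    (hf : ∀ x, f x ∈ Set.Icc (-1 : ℝ) 1)
    (hd : ∀ S : Finset (Fin N), d < S.card → wCoeff f S = 0) :
    Real.sqrt (∑ S ∈ Finset.univ.filter
        (fun S : Finset (Fin N) => 0 < S.card ∧ S.card ≤ d), wCoeff f S ^ 2) ≤
      2 * Real.exp d * (1 - |wCoeff f ∅|) := by
  obtain ⟨a, ha⟩ : ∃ a, a = wCoeff f ∅ := ⟨_, rfl⟩
  have hempty : wCoeff (fun x => f x - a) ∅ = 0 := by
    rw [wCoeff_sub, ← ha, wCoeff_empty]
    simp
  have hcoeff : ∀ S : Finset (Fin N), S.Nonempty →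
      wCoeff (fun x => f x - a) S = wCoeff f S := by
    intro S hS
    rw [wCoeff_sub, wCoeff_const a hS, sub_zero]
  have hdeg : ∀ S : Finset (Fin N), d < S.card → wCoeff (fun x => f x - a) S = 0 := by
    intro S hS
    rw [hcoeff S (card_pos.1 (by omega)), hd S hS]
  have hsum : ∑ S ∈ univ.filter (fun S : Finset (Fin N) => 0 < S.card ∧ S.card ≤ d),
      wCoeff f S ^ 2 = (∑ x, (f x - a) ^ 2) / 2 ^ N := by
    rw [← sum_wCoeff_sq, sum_filter]
    refine sum_congr rfl fun S _ => ?_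
    rcases S.eq_empty_or_nonempty with rfl | hS
    · simp [hempty]
    · rw [hcoeff S hS]
      split_ifs with h
      · rfl
      · rw [hd S (by have := card_pos.2 hS; omega)]
        norm_num
  rw [hsum]
  calc _ ≤ exp d * ((∑ x, |f x - a|) / 2 ^ N) := sqrt_cubeAvg_sq_le _ hdeg
    _ ≤ exp d * (2 * (1 - |wCoeff f ∅|)) := by
        rw [ha]
        gcongr
        exact cubeAvg_abs_sub_wCoeff_empty_le f hf
    _ = _ := by ring
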